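/- (Hochschild–Kostant–Rosenberg, affine case.) Let k be a field of characteristic zero and let R be a smooth commutative k-algebra (i.e. formally smooth and of finite type over k). Regard R as a module over the enveloping algebra R ⊗_k R via the multiplication map R ⊗_k R → R. Then for every i ≥ 0 there is an isomorphism of R-modules Tor_i^{R⊗_k R}(R, R) ≅ ⋀^i_R Ω_{R/k}, where Ω_{R/k} is the module of Kähler differentials and ⋀^i_R denotes the i-th exterior power over R. -/

import Mathlib

open CategoryTheory TensorProduct

namespace HKR

section Koszul

variable {A : Type} [CommRing A] {P : Type} [AddCommGroup P] [Module A P]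

open ExteriorAlgebra

/-- Contraction with `s` on the exterior algebra. -/
noncomputable def ctr (s : Module.Dual A P) :
    ExteriorAlgebra A P →ₗ[A] ExteriorAlgebra A P :=
  CliffordAlgebra.contractLeft s

lemma ctr_ι_mul (s : Module.Dual A P) (p : P) (w : ExteriorAlgebra A P) :
    ctr s (ι A p * w) = s p • w - ι A p * ctr s w :=
  CliffordAlgebra.contractLeft_ι_mul s p w

lemma ctr_algebraMap (s : Module.Dual A P) (a : A) :
    ctr s (algebraMap A _ a) = 0 :=
  CliffordAlgebra.contractLeft_algebraMap _ s a

lemma ctr_ctr (s : Module.Dual A P) (w : ExteriorAlgebra A P) :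
    ctr s (ctr s w) = 0 :=
  CliffordAlgebra.contractLeft_contractLeft s w

lemma ctr_mem (s : Module.Dual A P) {n : ℕ} {w : ExteriorAlgebra A P}
    (hw : w ∈ ⋀[A]^n P) : ctr s w ∈ ⋀[A]^(n - 1) P := by
  induction hw using Submodule.pow_induction_on_left' with
  | algebraMap r => rw [ctr_algebraMap]; exact zero_mem _
  | add x y i hx hy h1 h2 => rw [map_add]; exact add_mem h1 h2
  | mem_mul m hm i x hx ih =>
    obtain ⟨p, rfl⟩ := hm
    rw [ctr_ι_mul]
    refine sub_mem (Submodule.smul_mem _ _ hx) ?_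
    cases i with
    | zero =>
      rw [pow_zero] at hx
      obtain ⟨r, rfl⟩ := Submodule.mem_one.mp hx
      rw [ctr_algebraMap, mul_zero]; exact zero_mem _
    | succ i =>
      simp only [Nat.succ_eq_add_one, Nat.add_sub_cancel] at ih ⊢
      rw [exteriorPower, pow_succ']
      exact Submodule.mul_mem_mul ⟨p, rfl⟩ ih

/-- Koszul differential. -/
noncomputable def kd (s : Module.Dual A P) (n : ℕ) : ⋀[A]^(n + 1) P →ₗ[A] ⋀[A]^n P :=
  (ctr s).restrict (fun _ hw => ctr_mem (n := n + 1) s hw)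

lemma kd_coe (s : Module.Dual A P) (n : ℕ) (w : ⋀[A]^(n + 1) P) :
    (kd s n w : ExteriorAlgebra A P) = ctr s w := rfl

lemma kd_kd (s : Module.Dual A P) (n : ℕ) (w : ⋀[A]^(n + 2) P) :
    kd s n (kd s (n + 1) w) = 0 :=
  Subtype.ext (ctr_ctr s w)

/-- projection to degree `n`. -/
noncomputable def pr (n : ℕ) : ExteriorAlgebra A P →ₗ[A] ⋀[A]^n P :=
  (DirectSum.component A ℕ (fun i => ⋀[A]^i P) n).comp
    (DirectSum.decomposeLinearEquiv (fun i : ℕ => ⋀[A]^i P)).toLinearMap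

lemma pr_of_mem {n : ℕ} {w : ExteriorAlgebra A P} (hw : w ∈ ⋀[A]^n P) :
    pr n w = ⟨w, hw⟩ := by
  apply Subtype.ext
  exact DirectSum.decompose_of_mem_same (fun i : ℕ => ⋀[A]^i P) hw

lemma pr_of_mem_ne {m n : ℕ} (hmn : m ≠ n) {w : ExteriorAlgebra A P} (hw : w ∈ ⋀[A]^m P) :
    pr n w = 0 := by
  apply Subtype.ext
  exact DirectSum.decompose_of_mem_ne (fun i : ℕ => ⋀[A]^i P) hw hmn

lemma pr_ctr (s : Module.Dual A P) (n : ℕ) (w : ExteriorAlgebra A P) :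
    pr n (ctr s w) = kd s n (pr (n + 1) w) := by
  induction w using DirectSum.Decomposition.inductionOn fun i => ⋀[A]^i P with
  | zero => simp
  | add x y hx hy => simp only [map_add, hx, hy]
  | @homogeneous i m =>
    obtain ⟨m, hm⟩ := m
    by_cases h : i = n + 1
    · subst h
      rw [pr_of_mem hm]
      exact pr_of_mem (n := n) (ctr_mem (n := n + 1) s hm)
    · rw [pr_of_mem_ne h hm, map_zero]
      cases i with
      | zero =>
        obtain ⟨r, rfl⟩ := Submodule.mem_one.mp (by simpa [exteriorPower] using hm)
        rw [ctr_algebraMap, map_zero]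
      | succ i => exact pr_of_mem_ne (by omega) (ctr_mem (n := i + 1) s hm)


/-- The multiplication map `I ^ m ⊗ E → E`. -/
noncomputable def mulT (I : Ideal A) (m : ℕ) :
    ↥(I ^ m) ⊗[A] ExteriorAlgebra A P →ₗ[A] ExteriorAlgebra A P :=
  TensorProduct.lift ((LinearMap.lsmul A (ExteriorAlgebra A P)).comp (I ^ m).subtype)

@[simp] lemma mulT_tmul (I : Ideal A) (m : ℕ) (x : ↥(I ^ m)) (w : ExteriorAlgebra A P) :
    mulT I m (x ⊗ₜ w) = (x : A) • w := rfl

lemma mulT_injective [Module.Flat A (ExteriorAlgebra A P)] (I : Ideal A) (m : ℕ) :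
    Function.Injective (mulT (P := P) I m) := by
  have h := Module.Flat.iff_rTensor_injective'.mp
    (inferInstance : Module.Flat A (ExteriorAlgebra A P)) (I ^ m)
  have h2 : mulT (P := P) I m = (TensorProduct.lid A (ExteriorAlgebra A P)).toLinearMap ∘ₗ
      LinearMap.rTensor (ExteriorAlgebra A P) (I ^ m).subtype := by
    ext x w
    rfl
  rw [h2]
  exact (TensorProduct.lid A (ExteriorAlgebra A P)).injective.comp h

lemma smul_top_mul (I : Ideal A) (u : ExteriorAlgebra A P) {w : ExteriorAlgebra A P}
    (hw : w ∈ (I • ⊤ : Submodule A (ExteriorAlgebra A P))) :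
    u * w ∈ (I • ⊤ : Submodule A (ExteriorAlgebra A P)) := by
  have : (I • ⊤ : Submodule A (ExteriorAlgebra A P)) ≤
      (I • ⊤ : Submodule A (ExteriorAlgebra A P)).comap (LinearMap.mulLeft A u) := by
    rw [← Submodule.map_le_iff_le_comap, Submodule.map_smul'']
    exact Submodule.smul_mono le_rfl le_top
  exact this hw

lemma ι_mem_smul_top (I : Ideal A) {p : P} (hp : p ∈ (I • ⊤ : Submodule A P)) (u) :
    ι A p * u ∈ (I • ⊤ : Submodule A (ExteriorAlgebra A P)) := by
  have : (I • ⊤ : Submodule A P) ≤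
      (I • ⊤ : Submodule A (ExteriorAlgebra A P)).comap
        ((LinearMap.mulRight A u).comp (ι A)) := by
    rw [← Submodule.map_le_iff_le_comap, Submodule.map_smul'']
    exact Submodule.smul_mono le_rfl le_top
  exact this hp

/-- The map `x ⊗ ω ↦ dx ∧ ω`. -/
noncomputable def dT (d : A →+ P) (hd : ∀ a b, d (a * b) = a • d b + b • d a)
    (I : Ideal A) (m : ℕ) :
    ↥(I ^ m) ⊗[A] ExteriorAlgebra A P →ₗ[A]
      ExteriorAlgebra A P ⧸ (I ^ m • ⊤ : Submodule A (ExteriorAlgebra A P)) :=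
  TensorProduct.lift (LinearMap.mk₂ A (fun (x : ↥(I ^ m)) w =>
    (Submodule.mkQ (I ^ m • ⊤ : Submodule A (ExteriorAlgebra A P))) (ι A (d (x : A)) * w))
    (fun x y w => by simp [add_mul])
    (fun c x w => by
      rw [← map_smul, ← sub_eq_zero, ← map_sub]
      simp only [Submodule.mkQ_apply, Submodule.Quotient.mk_eq_zero]
      have : ι A (d ((c • x : ↥(I ^ m)) : A)) * w - c • (ι A (d (x : A)) * w)
          = (x : A) • (ι A (d c) * w) := by
        simp [hd, add_mul]
      rw [this]
      exact Submodule.smul_mem_smul x.2 trivial)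
    (fun x w w' => by simp [mul_add])
    (fun c x w => by simp))

lemma dT_tmul (d : A →+ P) (hd : ∀ a b, d (a * b) = a • d b + b • d a)
    (I : Ideal A) (m : ℕ) (x : ↥(I ^ m)) (w : ExteriorAlgebra A P) :
    dT d hd I m (x ⊗ₜ w) =
      (Submodule.mkQ (I ^ m • ⊤ : Submodule A (ExteriorAlgebra A P)))
        (ι A (d (x : A)) * w) := rfl

/-- `w` represents `d z` modulo `I ^ m`. -/
def Rel (d : A →+ P) (hd : ∀ a b, d (a * b) = a • d b + b • d a)
    (I : Ideal A) (m : ℕ) (z w : ExteriorAlgebra A P) : Prop :=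
  ∃ t, mulT I m t = z ∧ dT d hd I m t = Submodule.mkQ _ w

variable (d : A →+ P) (hd : ∀ a b, d (a * b) = a • d b + b • d a) (I : Ideal A)

lemma Rel.add {m : ℕ} {z w z' w' : ExteriorAlgebra A P} (h : Rel d hd I m z w)
    (h' : Rel d hd I m z' w') : Rel d hd I m (z + z') (w + w') := by
  obtain ⟨t, h1, h2⟩ := h
  obtain ⟨t', h1', h2'⟩ := h'
  exact ⟨t + t', by rw [map_add, h1, h1'], by rw [map_add, h2, h2', map_add]⟩

lemma Rel.neg {m : ℕ} {z w : ExteriorAlgebra A P} (h : Rel d hd I m z w) :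
    Rel d hd I m (-z) (-w) := by
  obtain ⟨t, h1, h2⟩ := h
  exact ⟨-t, by rw [map_neg, h1], by rw [map_neg, h2, map_neg]⟩

lemma Rel.zero {m : ℕ} : Rel (P := P) d hd I m 0 0 := ⟨0, by simp, by simp⟩

lemma Rel.congr {m : ℕ} {z w w' : ExteriorAlgebra A P} (h : Rel d hd I m z w)
    (hw : w' - w ∈ (I ^ m • ⊤ : Submodule A (ExteriorAlgebra A P))) :
    Rel d hd I m z w' := by
  obtain ⟨t, h1, h2⟩ := h
  refine ⟨t, h1, ?_⟩
  rw [h2, eq_comm, ← sub_eq_zero, ← map_sub]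
  exact (Submodule.Quotient.mk_eq_zero _).mpr hw

lemma Rel.of {m : ℕ} {x : A} (hx : x ∈ I ^ m) (w : ExteriorAlgebra A P) :
    Rel d hd I m (x • w) (ι A (d x) * w) :=
  ⟨⟨x, hx⟩ ⊗ₜ w, by simp, rfl⟩

lemma Rel.unique [Module.Flat A (ExteriorAlgebra A P)] {m : ℕ} {z w w' : ExteriorAlgebra A P}
    (h : Rel d hd I m z w) (h' : Rel d hd I m z w') :
    w' - w ∈ (I ^ m • ⊤ : Submodule A (ExteriorAlgebra A P)) := by
  obtain ⟨t, h1, h2⟩ := h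
  obtain ⟨t', h1', h2'⟩ := h'
  obtain rfl : t = t' := mulT_injective I m (h1.trans h1'.symm)
  rw [h2] at h2'
  rw [eq_comm, ← sub_eq_zero, ← map_sub] at h2'
  exact (Submodule.Quotient.mk_eq_zero _).mp h2'

lemma Rel.exists_of_mem {m : ℕ} {z : ExteriorAlgebra A P}
    {N : Submodule A (ExteriorAlgebra A P)} (hz : z ∈ I ^ m • N)
    {Q : ExteriorAlgebra A P → ExteriorAlgebra A P → Prop}
    (h1 : ∀ x ∈ I ^ m, ∀ w ∈ N, Q (x • w) (ι A (d x) * w))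
    (h2 : ∀ z w z' w', Q z w → Q z' w' → Q (z + z') (w + w')) :
    ∃ w, Rel d hd I m z w ∧ Q z w := by
  induction hz using Submodule.smul_induction_on' with
  | smul x hx w hw => exact ⟨_, Rel.of d hd I hx w, h1 x hx w hw⟩
  | add x hx y hy ih1 ih2 =>
    obtain ⟨w, hw, hw'⟩ := ih1
    obtain ⟨v, hv, hv'⟩ := ih2
    exact ⟨w + v, hw.add _ _ _ hv, h2 _ _ _ _ hw' hv'⟩

lemma Rel.mem {m : ℕ} {z w : ExteriorAlgebra A P} (h : Rel d hd I m z w) :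
    z ∈ (I ^ m • ⊤ : Submodule A (ExteriorAlgebra A P)) := by
  obtain ⟨t, rfl, -⟩ := h
  induction t with
  | zero => simp
  | tmul x y => exact Submodule.smul_mem_smul x.2 trivial
  | add x y hx hy => rw [map_add]; exact add_mem hx hy

lemma Rel.smul_one [Module.Flat A (ExteriorAlgebra A P)] {m : ℕ} {x : A} (hx : x ∈ I ^ m)
    {η θ : ExteriorAlgebra A P} (h : Rel d hd I 1 η θ) :
    Rel d hd I (m + 1) (x • η) (ι A (d x) * η + x • θ) := by
  obtain ⟨θ', h', hQ⟩ := Rel.exists_of_mem d hd I (N := ⊤) (m := 1) (z := η) h.mem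
    (Q := fun η θ => Rel d hd I (m + 1) (x • η) (ι A (d x) * η + x • θ))
    (fun y hy w _ => by
      have := Rel.of d hd I (m := m + 1) (x := x * y)
        (by rw [pow_succ]; exact Ideal.mul_mem_mul hx (by simpa using hy)) w
      rw [hd] at this
      simp only [map_add, map_smul, add_mul, mul_smul, smul_mul_assoc] at this
      simpa [add_comm] using this)
    (fun z w z' w' h h' => by
      have := h.add _ _ _ h'
      convert this using 1
      · rw [smul_add]
      · rw [mul_add, smul_add]; abel)
  refine hQ.congr _ _ _ ?_
  have := Rel.unique d hd I h' h
  rw [add_sub_add_left_eq_sub, ← smul_sub, pow_succ, ← smul_eq_mul, Submodule.smul_assoc]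
  rw [pow_one] at this
  exact Submodule.smul_mem_smul hx this

lemma Rel.ι_mul [Module.Flat A (ExteriorAlgebra A P)] (p : P)
    {η θ : ExteriorAlgebra A P} (h : Rel d hd I 1 η θ) :
    Rel d hd I 1 (ι A p * η) (-(ι A p * θ)) := by
  obtain ⟨θ', h', hQ⟩ := Rel.exists_of_mem d hd I (N := ⊤) (m := 1) (z := η) h.mem
    (Q := fun η θ => Rel d hd I 1 (ι A p * η) (-(ι A p * θ)))
    (fun y hy w _ => by
      have := Rel.of d hd I hy (ι A p * w)
      convert this using 1
      · simp
      · rw [← mul_assoc, ← mul_assoc, ← neg_mul]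
        congr 1
        rw [neg_eq_iff_add_eq_zero]
        exact ι_add_mul_swap _ _)
    (fun z w z' w' h h' => by
      have := h.add _ _ _ h'
      convert this using 1
      · rw [mul_add]
      · rw [mul_add, neg_add])
  refine hQ.congr _ _ _ ?_
  have := Rel.unique d hd I h h'
  rw [neg_sub_neg, ← mul_sub]
  exact smul_top_mul _ _ this

variable (s : Module.Dual A P) (hs : ∀ p, s p ∈ I)
  (hsd : ∀ x ∈ I, s (d x) - x ∈ I ^ 2)
  (hds : ∀ p, d (s p) - p ∈ (I • ⊤ : Submodule A P))

include hs hds in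
lemma Rel.ctr [Module.Flat A (ExteriorAlgebra A P)] {n : ℕ} {w : ExteriorAlgebra A P}
    (hw : w ∈ ⋀[A]^n P) : Rel d hd I 1 (ctr s w) ((n : A) • w) := by
  induction hw using Submodule.pow_induction_on_left' with
  | algebraMap r => rw [ctr_algebraMap]; simpa using Rel.zero d hd I
  | add x y i hx hy h1 h2 => rw [map_add, smul_add]; exact h1.add _ _ _ h2
  | mem_mul m hm i x hx ih =>
    obtain ⟨p, rfl⟩ := hm
    rw [ctr_ι_mul, sub_eq_add_neg]
    have h1 := Rel.of d hd I (m := 1) (x := s p) (by simpa using hs p) x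
    have h2 := h1.congr d hd I (w' := ι A p * x) (by
      rw [← sub_mul, ← map_sub, pow_one]
      apply ι_mem_smul_top
      rw [← neg_sub]
      exact neg_mem (hds p))
    have := h2.add _ _ _ ((ih.ι_mul d hd I p).neg)
    convert this using 1
    simp [add_smul, add_comm]

include hd hs hsd in
lemma sd_pow (m : ℕ) {x : A} (hx : x ∈ I ^ m) : s (d x) - m * x ∈ I ^ (m + 1) := by
  induction m generalizing x with
  | zero => simpa using hs _
  | succ m ih =>
    rw [pow_succ] at hx
    induction hx using Submodule.mul_induction_on' with
    | mem_mul_mem a ha b hb =>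
      rw [hd]
      have h1 := Ideal.mul_mem_mul ha (hsd b hb)
      have h2 := Ideal.mul_mem_mul (ih ha) hb
      have h1' : a * (s (d b) - b) ∈ I ^ (m + 2) := by rwa [← pow_add] at h1
      have h2' : (s (d a) - m * a) * b ∈ I ^ (m + 2) := by rwa [← pow_succ] at h2
      convert add_mem h1' h2' using 1
      simp only [map_add, map_smul, smul_eq_mul]
      push_cast
      ring
    | add x hx y hy h1 h2 =>
      have := add_mem h1 h2
      convert this using 1
      simp only [map_add]
      ring

include hs in
lemma ctr_smul_top {w : ExteriorAlgebra A P} :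
    ctr s w ∈ (I • ⊤ : Submodule A (ExteriorAlgebra A P)) := by
  induction w using CliffordAlgebra.left_induction with
  | algebraMap r => exact (ctr_algebraMap s r) ▸ zero_mem _
  | add x y h1 h2 => rw [map_add]; exact add_mem h1 h2
  | ι_mul x p h =>
    have := ctr_ι_mul s p x
    erw [this]
    exact sub_mem (Submodule.smul_mem_smul (hs p) trivial) (smul_top_mul _ _ h)

include hd hs hsd hds in
lemma key [Module.Flat A (ExteriorAlgebra A P)] {m n : ℕ} {z : ExteriorAlgebra A P}
    (hz : z ∈ I ^ m • (⋀[A]^n P)) (hz0 : ctr s z = 0) :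
    ∃ w, ctr s w - ((m + n : ℕ) : A) • z ∈
      (I ^ (m + 1) • ⊤ : Submodule A (ExteriorAlgebra A P)) := by
  obtain ⟨w, hw, w', hw', h⟩ := Rel.exists_of_mem d hd I hz
    (Q := fun z w => ∃ w', Rel d hd I (m + 1) (HKR.ctr s z) w' ∧
      HKR.ctr s w + w' - ((m + n : ℕ) : A) • z ∈
        (I ^ (m + 1) • ⊤ : Submodule A (ExteriorAlgebra A P)))
    (fun x hx w hw => by
      refine ⟨_, by
        rw [map_smul]
        exact (Rel.ctr d hd I s hs hds hw).smul_one d hd I hx, ?_⟩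
      rw [ctr_ι_mul]
      have : s (d x) • w - ι A (d x) * HKR.ctr s w +
          (ι A (d x) * HKR.ctr s w + x • (n : A) • w) - ((m + n : ℕ) : A) • x • w
          = (s (d x) - m * x) • w := by
        push_cast
        module
      rw [this]
      exact Submodule.smul_mem_smul (sd_pow d hd I s hs hsd m hx) trivial)
    (fun z w z' w' ⟨v, hv, h⟩ ⟨v', hv', h'⟩ => by
      refine ⟨v + v', by rw [map_add]; exact hv.add _ _ _ hv', ?_⟩
      convert add_mem h h' using 1
      rw [map_add, smul_add]; abel)
  refine ⟨w, ?_⟩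
  rw [hz0] at hw'
  have := Rel.unique d hd I (Rel.zero d hd I) hw'
  convert sub_mem h this using 1
  abel

lemma pr_smul_top {m n : ℕ} {w : ExteriorAlgebra A P}
    (hw : w ∈ (I ^ m • ⊤ : Submodule A (ExteriorAlgebra A P))) :
    pr n w ∈ (I ^ m • ⊤ : Submodule A (⋀[A]^n P)) := by
  have : (I ^ m • ⊤ : Submodule A (ExteriorAlgebra A P)) ≤
      (I ^ m • ⊤ : Submodule A (⋀[A]^n P)).comap (pr n) := by
    rw [← Submodule.map_le_iff_le_comap, Submodule.map_smul'']
    exact Submodule.smul_mono le_rfl le_top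
  exact this hw

include hd hs hsd hds in
lemma step [Module.Flat A (ExteriorAlgebra A P)] {m n : ℕ} {z : ⋀[A]^n P}
    (hmn : IsUnit ((m + n : ℕ) : A))
    (hz : z ∈ (I ^ m • ⊤ : Submodule A (⋀[A]^n P)))
    (hz0 : ctr s (z : ExteriorAlgebra A P) = 0) :
    ∃ w, z - kd s n w ∈ (I ^ (m + 1) • ⊤ : Submodule A (⋀[A]^n P)) := by
  have hz' : (z : ExteriorAlgebra A P) ∈ I ^ m • (⋀[A]^n P) := by
    have := Submodule.mem_map_of_mem (f := (⋀[A]^n P).subtype) hz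
    rw [Submodule.map_smul''] at this
    simpa using this
  obtain ⟨w, hw⟩ := key d hd I s hs hsd hds hz' hz0
  have h1 := pr_smul_top I (n := n) hw
  rw [map_sub, map_smul, pr_ctr, pr_of_mem z.2] at h1
  obtain ⟨u, hu⟩ := hmn
  refine ⟨(↑u⁻¹ : A) • pr (n + 1) w, ?_⟩
  have h2 := Submodule.smul_mem _ (-(↑u⁻¹ : A)) h1
  convert h2 using 1
  rw [← hu, map_smul, smul_sub, smul_smul]
  simp
  abel

include hd hs hsd hds in
lemma exact_upto [Module.Flat A (ExteriorAlgebra A P)] [IsNoetherianRing A] [Module.Finite A P]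
    {n m₀ : ℕ} {z : ⋀[A]^n P} (hm₀ : m₀ + n ≠ 0)
    (hunit : ∀ m : ℕ, m ≠ 0 → IsUnit (m : A))
    (hz : z ∈ (I ^ m₀ • ⊤ : Submodule A (⋀[A]^n P)))
    (hz0 : ctr s (z : ExteriorAlgebra A P) = 0) :
    ∃ r ∈ I, ∃ w, (1 - r) • z = kd s n w := by
  have h : ∀ m, ∃ w, z - kd s n w ∈ (I ^ (m₀ + m) • ⊤ : Submodule A (⋀[A]^n P)) := by
    intro m
    induction m with
    | zero => exact ⟨0, by simpa using hz⟩
    | succ m ih =>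
      obtain ⟨w, hw⟩ := ih
      obtain ⟨w', hw'⟩ := step d hd I s hs hsd hds (hunit (m₀ + m + n) (by omega)) hw (by
        simp [hz0, kd_coe, ctr_ctr])
      exact ⟨w + w', by rwa [map_add, ← sub_sub]⟩
  have h2 : (Submodule.mkQ (LinearMap.range (kd s n)) z) ∈
      (⨅ i : ℕ, I ^ i • ⊤ : Submodule A (⋀[A]^n P ⧸ LinearMap.range (kd s n))) := by
    rw [Submodule.mem_iInf]
    intro m
    obtain ⟨w, hw⟩ := h m
    have h3 := Submodule.mem_map_of_mem (f := Submodule.mkQ (LinearMap.range (kd s n))) hw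
    rw [Submodule.map_smul'', map_sub] at h3
    have h4 : (Submodule.mkQ (LinearMap.range (kd s n))) (kd s n w) = 0 := by simp
    rw [h4, sub_zero] at h3
    exact Submodule.smul_mono (Ideal.pow_le_pow_right (by omega)) le_top h3
  rw [Ideal.mem_iInf_smul_pow_eq_bot_iff] at h2
  obtain ⟨r, hr⟩ := h2
  refine ⟨r, r.2, ?_⟩
  rw [← map_smul, ← sub_eq_zero, ← map_sub, ← neg_eq_zero, ← map_neg] at hr
  simp only [Submodule.mkQ_apply, Submodule.Quotient.mk_eq_zero] at hr
  obtain ⟨w, hw⟩ := hr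
  exact ⟨w, by rw [hw]; module⟩

end Koszul

open ExteriorAlgebra in
instance projExt {A : Type} [CommRing A] {P : Type} [AddCommGroup P] [Module A P]
    [Module.Projective A P] (n : ℕ) : Module.Projective A (⋀[A]^n P) := by
  obtain ⟨s, hs⟩ := Module.projective_def'.mp (inferInstance : Module.Projective A P)
  refine Module.Projective.of_split (exteriorPower.map n s)
    (exteriorPower.map n (Finsupp.linearCombination A id)) ?_
  rw [← exteriorPower.map_comp, hs, exteriorPower.map_id]

open ExteriorAlgebra in
lemma flatExt {A : Type} [CommRing A] {P : Type} [AddCommGroup P] [Module A P]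
    [Module.Projective A P] : Module.Flat A (ExteriorAlgebra A P) := by
  have : Module.Projective A (ExteriorAlgebra A P) :=
    Module.Projective.of_equiv (DirectSum.decomposeLinearEquiv (fun i : ℕ => ⋀[A]^i P)).symm
  infer_instance

section Tor

variable {A : Type} [CommRing A] (S : Submonoid A)

open ModuleCat Limits

lemma loc_exact_aux {M N Q M' N' Q' : Type} [AddCommGroup M] [AddCommGroup N] [AddCommGroup Q]
    [AddCommGroup M'] [AddCommGroup N'] [AddCommGroup Q']
    [Module A M] [Module A N] [Module A Q] [Module A M'] [Module A N'] [Module A Q']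
    (lM : M →ₗ[A] M') (lN : N →ₗ[A] N') (lQ : Q →ₗ[A] Q')
    [IsLocalizedModule S lM] [IsLocalizedModule S lN] [IsLocalizedModule S lQ]
    (f : M →ₗ[A] N) (g : N →ₗ[A] Q)
    (hfg : ∀ x, g (f x) = 0)
    (h : ∀ z, g z = 0 → ∃ s ∈ S, ∃ w, s • z = f w) :
    Function.Exact (IsLocalizedModule.map S lM lN f) (IsLocalizedModule.map S lN lQ g) := by
  intro y
  constructor
  · intro hy
    obtain ⟨⟨n, t⟩, rfl⟩ := IsLocalizedModule.mk'_surjective S lN y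
    simp only [Function.uncurry_apply_pair, IsLocalizedModule.map_mk'] at hy ⊢
    rw [IsLocalizedModule.mk'_eq_zero'] at hy
    obtain ⟨u, hu⟩ := hy
    obtain ⟨s, hs, w, hw⟩ := h ((u : A) • n) (by
      rw [← hu, map_smul]; rfl)
    refine ⟨IsLocalizedModule.mk' lM w (⟨s, hs⟩ * u * t), ?_⟩
    have e : f w = ((⟨s, hs⟩ : S) * u) • n := by
      rw [← hw, smul_smul]; rfl
    rw [IsLocalizedModule.map_mk', e, IsLocalizedModule.mk'_cancel_left]
  · rintro ⟨x, rfl⟩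
    obtain ⟨⟨m, t⟩, rfl⟩ := IsLocalizedModule.mk'_surjective S lM x
    simp [hfg]

lemma loc_exact {M N Q : ModuleCat.{0} A} (f : M ⟶ N) (g : N ⟶ Q)
    (hfg : ∀ x, g (f x) = 0)
    (h : ∀ z, g z = 0 → ∃ s ∈ S, ∃ w, s • z = f w) :
    Function.Exact ((localizedModuleFunctor S).map f) ((localizedModuleFunctor S).map g) :=
  loc_exact_aux S (M.localizedModuleMkLinearMap S) (N.localizedModuleMkLinearMap S)
    (Q.localizedModuleMkLinearMap S) f.hom g.hom hfg h

lemma loc_surj {M N : ModuleCat.{0} A} (f : M ⟶ N)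
    (h : Function.Surjective f) :
    Function.Surjective ((localizedModuleFunctor S).map f) :=
  IsLocalizedModule.map_surjective S (M.localizedModuleMkLinearMap S)
    (N.localizedModuleMkLinearMap S) f.hom h

lemma quasiIso_of_aug {C : Type*} [Category C] [Abelian C] (L : ChainComplex C ℕ) (X : C)
    (ε : L.X 0 ⟶ X) (hz : L.d 1 0 ≫ ε = 0) (he : Epi ε)
    (h0 : (ShortComplex.mk (L.d 1 0) ε hz).Exact)
    (h1 : ∀ n, (ShortComplex.mk (L.d (n + 2) (n + 1)) (L.d (n + 1) n) (L.d_comp_d _ _ _)).Exact) :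
    QuasiIso ((ChainComplex.toSingle₀Equiv L X).symm ⟨ε, hz⟩) := by
  constructor
  intro n
  cases n with
  | zero =>
    rw [ChainComplex.quasiIsoAt₀_iff, ShortComplex.quasiIso_iff_of_zeros']
    rotate_left
    · exact L.shape _ _ (by simp)
    · rfl
    · rfl
    · refine (ShortComplex.exact_and_epi_g_iff_of_iso ?_).2 ⟨h0, he⟩
      refine ShortComplex.isoMk (Iso.refl _) (Iso.refl _) (Iso.refl _) ?_ ?_
      · exact (Category.id_comp _).trans (Category.comp_id _).symm
      · refine (Category.id_comp _).trans (Eq.trans ?_ (Category.comp_id _).symm)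
        exact (ChainComplex.toSingle₀Equiv_symm_apply_f_zero ε hz).symm
  | succ n =>
    rw [quasiIsoAt_iff_exactAt']
    · rw [HomologicalComplex.exactAt_iff' _ (n + 1 + 1) (n + 1) n (by simp) (by simp)]
      exact h1 n
    · exact ChainComplex.exactAt_succ_single_obj _ _

lemma exists_resolution (R : ModuleCat.{0} A) (K : ChainComplex (ModuleCat.{0} A) ℕ)
    (hK : ∀ n, Projective (K.X n)) (ε : K.X 0 ⟶ R) (hε : Function.Surjective ε)
    (hdε : K.d 1 0 ≫ ε = 0)
    (h0 : ∀ z, ε z = 0 → ∃ s ∈ S, ∃ w, s • z = K.d 1 0 w)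
    (h1 : ∀ n z, K.d (n + 1) n z = 0 → ∃ s ∈ S, ∃ w, s • z = K.d (n + 2) (n + 1) w) :
    ∃ Q : ProjectiveResolution ((localizedModuleFunctor S).obj R),
      Q.complex = ((localizedModuleFunctor S).mapHomologicalComplex _).obj K := by
  let F := localizedModuleFunctor.{0} S
  let FK := (F.mapHomologicalComplex (ComplexShape.down ℕ)).obj K
  have hz : FK.d 1 0 ≫ F.map ε = 0 := by
    change F.map _ ≫ F.map ε = 0
    rw [← F.map_comp, hdε, F.map_zero]
  have e1 : (ShortComplex.mk (FK.d 1 0) (F.map ε) hz).Exact := by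
    rw [ShortComplex.ShortExact.moduleCat_exact_iff_function_exact]
    exact loc_exact S _ _ (fun x => by
      rw [← ModuleCat.comp_apply, hdε]; rfl) h0
  have e2 : Epi (F.map ε) := by
    rw [ModuleCat.epi_iff_surjective]
    exact loc_surj S ε hε
  have hq := quasiIso_of_aug FK (F.obj R) (F.map ε) hz e2 e1 (fun n => by
    rw [ShortComplex.ShortExact.moduleCat_exact_iff_function_exact]
    exact loc_exact S _ _ (fun x => by
      rw [← ModuleCat.comp_apply, K.d_comp_d]; rfl) (h1 n))
  exact ⟨{ complex := FK, projective := fun n => F.projective_obj _, π := _, quasiIso := hq }, rfl⟩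

end Tor

section Tor2

variable {A : Type} [CommRing A] (S : Submonoid A)

open ModuleCat Limits MonoidalCategory

lemma lTensor_bij {M M' R : Type} [AddCommGroup M] [AddCommGroup M'] [AddCommGroup R]
    [Module A M] [Module A M'] [Module A R]
    (hS : ∀ s ∈ S, ∀ r : R, s • r = r) (l : M →ₗ[A] M') [IsLocalizedModule S l] :
    Function.Bijective (l.lTensor R) := by
  constructor
  · have hu : ∀ x : S, IsUnit (algebraMap A (Module.End A (R →ₗ[A] R ⊗[A] M)) x) := by
      intro x
      convert isUnit_one
      ext f r
      simp only [Module.algebraMap_end_apply, Module.End.one_apply, LinearMap.smul_apply]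
      rw [← map_smul, hS x x.2]
    let v : M' →ₗ[A] R →ₗ[A] R ⊗[A] M :=
      IsLocalizedModule.lift S l (TensorProduct.mk A R M).flip hu
    have hv : (TensorProduct.lift v.flip) ∘ₗ l.lTensor R = LinearMap.id := by
      ext r m
      simp [v]
    exact Function.LeftInverse.injective (g := TensorProduct.lift v.flip)
      (fun x => LinearMap.congr_fun hv x)
  · intro x
    induction x with
    | zero => exact ⟨0, map_zero _⟩
    | tmul r m =>
      obtain ⟨⟨m, s⟩, rfl⟩ := IsLocalizedModule.mk'_surjective S l m
      refine ⟨r ⊗ₜ m, ?_⟩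
      rw [LinearMap.lTensor_tmul, Function.uncurry_apply_pair]
      conv_rhs => rw [← hS s s.2 r, smul_tmul]
      congr 1
      exact (IsLocalizedModule.mk'_cancel' l m s).symm
    | add x y hx hy =>
      obtain ⟨a, rfl⟩ := hx
      obtain ⟨b, rfl⟩ := hy
      exact ⟨a + b, map_add _ _ _⟩

/-- The unit of localization. -/
noncomputable def etaEquiv (M : ModuleCat.{0} A) : M.localizedModule S ≃ₗ[A]
    ((restrictScalars (algebraMap A (Localization S))).obj (M.localizedModule S)) where
  toFun x := x
  invFun x := x
  map_add' _ _ := rfl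
  map_smul' a x := (algebraMap_smul (Localization S) a x).symm
  left_inv _ := rfl
  right_inv _ := rfl

/-- The unit of localization. -/
noncomputable def eta : 𝟭 (ModuleCat.{0} A) ⟶
    localizedModuleFunctor S ⋙ restrictScalars (algebraMap A (Localization S)) where
  app M := ModuleCat.ofHom (Y := (restrictScalars (algebraMap A (Localization S))).obj
      (M.localizedModule S))
    ((etaEquiv S M).toLinearMap ∘ₗ M.localizedModuleMkLinearMap S)
  naturality M N f := by
    ext x
    exact (IsLocalizedModule.map_apply S (M.localizedModuleMkLinearMap S)
      (N.localizedModuleMkLinearMap S) f.hom x).symm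

variable (R : ModuleCat.{0} A) 

lemma isIso_eta (hS : ∀ s ∈ S, ∀ r : R, s • r = r) (M : ModuleCat.{0} A) :
    IsIso (R ◁ (eta S).app M) := by
  rw [ConcreteCategory.isIso_iff_bijective]
  have : IsLocalizedModule S ((etaEquiv S M).toLinearMap ∘ₗ M.localizedModuleMkLinearMap S) :=
    IsLocalizedModule.of_linearEquiv S _ (etaEquiv S M)
  refine Eq.mpr ?_ (lTensor_bij S (R := R) hS ((etaEquiv S M).toLinearMap ∘ₗ M.localizedModuleMkLinearMap S))
  rfl

/-- The localization isomorphism on tensor products. -/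
noncomputable def tensorIso (hS : ∀ s ∈ S, ∀ r : R, s • r = r) :
    (tensoringLeft (ModuleCat.{0} A)).obj R ≅ localizedModuleFunctor S ⋙
      (restrictScalars (algebraMap A (Localization S)) ⋙ (tensoringLeft (ModuleCat.{0} A)).obj R) :=
  NatIso.ofComponents (fun M => @asIso _ _ _ _ (R ◁ (eta S).app M) (isIso_eta S R hS M)) (by
    intro M N f
    have := (eta S).naturality f
    change R ◁ f ≫ R ◁ (eta S).app N = R ◁ (eta S).app M ≫ R ◁ _
    rw [← MonoidalCategory.whiskerLeft_comp, ← MonoidalCategory.whiskerLeft_comp]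
    exact congrArg (fun g => R ◁ g) this)

theorem tor_iso (hS : ∀ s ∈ S, ∀ r : R, s • r = r) (K : ChainComplex (ModuleCat.{0} A) ℕ)
    (hK : ∀ n, Projective (K.X n)) (ε : K.X 0 ⟶ R) (hε : Function.Surjective ε)
    (hdε : K.d 1 0 ≫ ε = 0)
    (h0 : ∀ z, ε z = 0 → ∃ s ∈ S, ∃ w, s • z = K.d 1 0 w)
    (h1 : ∀ n z, K.d (n + 1) n z = 0 → ∃ s ∈ S, ∃ w, s • z = K.d (n + 2) (n + 1) w) (i : ℕ) :
    Nonempty (((Tor (ModuleCat.{0} A) i).obj R).obj R ≅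
      ((((tensoringLeft (ModuleCat.{0} A)).obj R).mapHomologicalComplex _).obj K).homology i) := by
  obtain ⟨Q, hQ⟩ := exists_resolution S R K hK ε hε hdε h0 h1
  let F := localizedModuleFunctor.{0} S
  let G := restrictScalars (algebraMap A (Localization S)) ⋙ (tensoringLeft (ModuleCat.{0} A)).obj R
  let T := (tensoringLeft (ModuleCat.{0} A)).obj R
  let α : T ≅ F ⋙ G := tensorIso S R hS
  let Q₀ := ProjectiveResolution.of R
  let β : T.mapHomologicalComplex (ComplexShape.down ℕ) ≅
    (F ⋙ G).mapHomologicalComplex (ComplexShape.down ℕ) := NatIso.mapHomologicalComplex α _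
  let γ := HomologicalComplex.homologyFunctor (ModuleCat.{0} A) (ComplexShape.down ℕ) i
  have e1 := Q₀.isoLeftDerivedObj T i
  have e2 : γ.obj ((T.mapHomologicalComplex _).obj Q₀.complex) ≅
    γ.obj ((G.mapHomologicalComplex _).obj ((F.mapHomologicalComplex _).obj Q₀.complex)) :=
    γ.mapIso (β.app _)
  have e3 := (F.mapProjectiveResolution Q₀).isoLeftDerivedObj G i
  have e4 := Q.isoLeftDerivedObj G i
  rw [hQ] at e4
  have e5 : γ.obj ((T.mapHomologicalComplex _).obj K) ≅
    γ.obj ((G.mapHomologicalComplex _).obj ((F.mapHomologicalComplex _).obj K)) :=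
    γ.mapIso (β.app _)
  exact ⟨e1 ≪≫ e2 ≪≫ e3.symm ≪≫ e4 ≪≫ e5.symm⟩

end Tor2

section TorK

variable {A : Type} [CommRing A] {P : Type} [AddCommGroup P] [Module A P]

open ModuleCat Limits MonoidalCategory

/-- The submonoid `1 + I`. -/
def oneAdd (I : Ideal A) : Submonoid A := Submonoid.comap (Ideal.Quotient.mk I) ⊥

lemma mem_oneAdd (I : Ideal A) (a : A) : a ∈ oneAdd I ↔ a - 1 ∈ I := by
  rw [oneAdd, Submonoid.mem_comap, Submonoid.mem_bot, ← Ideal.Quotient.eq, map_one]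

lemma kd_smul_top (I : Ideal A) (s : Module.Dual A P) (hs : ∀ p, s p ∈ I) (n : ℕ)
    (w : ⋀[A]^(n + 1) P) : kd s n w ∈ (I • ⊤ : Submodule A (⋀[A]^n P)) := by
  have h1 := ctr_smul_top I s hs (w := w)
  rw [← pow_one I] at h1
  have h2 := pr_smul_top I (n := n) h1
  rwa [pow_one, pr_ctr, pr_of_mem w.2] at h2

/-- The Koszul complex. -/
noncomputable def kosz (s : Module.Dual A P) : ChainComplex (ModuleCat.{0} A) ℕ :=
  ChainComplex.of (fun n => ModuleCat.of A (⋀[A]^n P)) (fun n => ModuleCat.ofHom (kd s n))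
    (fun n => by
      rw [← ModuleCat.ofHom_comp, LinearMap.ext (f := kd s n ∘ₗ kd s (n + 1)) (g := 0) (kd_kd s n)]
      rfl)

lemma kosz_d (s : Module.Dual A P) (n : ℕ) :
    (kosz s).d (n + 1) n = ModuleCat.ofHom (kd s n) :=
  ChainComplex.of_d (fun n => ModuleCat.of A (⋀[A]^n P)) (fun n => ModuleCat.ofHom (kd s n)) n

lemma ctr_zero (s : Module.Dual A P) (z : ⋀[A]^0 P) : ctr s (z : ExteriorAlgebra A P) = 0 := by
  obtain ⟨z, hz⟩ := z
  obtain ⟨r, rfl⟩ := Submodule.mem_one.mp (by simpa [exteriorPower] using hz)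
  exact ctr_algebraMap s r

lemma homology_of_zero {C : Type*} [Category C] [Abelian C] (L : ChainComplex C ℕ)
    (h : ∀ n, L.d (n + 1) n = 0) (i : ℕ) : Nonempty (L.homology i ≅ L.X i) := by
  have h' : ∀ m n, L.d m n = 0 := by
    intro m n
    by_cases hmn : n + 1 = m
    · subst hmn; exact h n
    · exact L.shape _ _ hmn
  exact ⟨(ShortComplex.HomologyData.ofZeros (L.sc i) (h' _ _) (h' _ _)).left.homologyIso⟩

theorem tor_koszul (d : A →+ P) (hd : ∀ a b, d (a * b) = a • d b + b • d a) (I : Ideal A)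
    (s : Module.Dual A P) (hs : ∀ p, s p ∈ I)
    (hsd : ∀ x ∈ I, s (d x) - x ∈ I ^ 2)
    (hds : ∀ p, d (s p) - p ∈ (I • ⊤ : Submodule A P))
    [Module.Projective A P] [IsNoetherianRing A] [Module.Finite A P]
    (hunit : ∀ m : ℕ, m ≠ 0 → IsUnit (m : A))
    (R : Type) [AddCommGroup R] [Module A R] (hR : ∀ a ∈ I, ∀ r : R, a • r = 0)
    (ε : A →ₗ[A] R) (hε : Function.Surjective ε) (hker : ∀ a, ε a = 0 ↔ a ∈ I) (i : ℕ) :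
    Nonempty ((((Tor (ModuleCat.{0} A) i).obj (ModuleCat.of A R)).obj (ModuleCat.of A R)) ≃ₗ[A]
      R ⊗[A] ⋀[A]^i P) := by
  have hflat : Module.Flat A (ExteriorAlgebra A P) := flatExt
  let e0 := exteriorPower.zeroEquiv A P
  have he0 : ∀ (z : ⋀[A]^0 P), e0 z ∈ I ↔ z ∈ (I • ⊤ : Submodule A (⋀[A]^0 P)) := by
    intro z
    constructor
    · intro h
      have : z = e0 z • e0.symm 1 := by
        apply e0.injective
        simp
      rw [this]
      exact Submodule.smul_mem_smul h trivial
    · intro h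
      have h2 := Submodule.mem_map_of_mem (f := e0.toLinearMap) h
      rw [Submodule.map_smul''] at h2
      have h3 : e0 z ∈ I • (⊤ : Submodule A A) := Submodule.smul_mono le_rfl le_top h2
      simpa using h3
  obtain ⟨φ⟩ := tor_iso (oneAdd I) (ModuleCat.of A R) (fun a ha r => by
      have h1 := hR _ ((mem_oneAdd I a).mp ha) r
      rw [sub_smul, one_smul, sub_eq_zero] at h1
      exact h1)
    (kosz s) (fun n => (IsProjective.iff_projective _).mp (projExt (A := A) (P := P) n))
    (ModuleCat.ofHom (ε ∘ₗ e0.toLinearMap)) (hε.comp e0.surjective)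
    (by
      rw [kosz_d]
      ext w
      exact (hker _).mpr ((he0 _).mpr (kd_smul_top I s hs 0 w)))
    (by
      intro z hz
      obtain ⟨r, hr, w, hw⟩ := exact_upto d hd I s hs hsd hds (n := 0) (m₀ := 1) (z := z)
        (by simp) hunit (by
          rw [pow_one]
          exact (he0 z).mp ((hker _).mp hz)) (ctr_zero s z)
      refine ⟨1 - r, (mem_oneAdd I _).mpr (by simpa using hr), w, ?_⟩
      rw [kosz_d]
      exact hw)
    (by
      intro n z hz
      rw [kosz_d] at hz
      obtain ⟨r, hr, w, hw⟩ := exact_upto d hd I s hs hsd hds (n := n + 1) (m₀ := 0) (z := z)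
        (by simp) hunit (by rw [pow_zero, Ideal.one_eq_top, Submodule.top_smul]; trivial) (congrArg Subtype.val hz)
      refine ⟨1 - r, (mem_oneAdd I _).mpr (by simpa using hr), w, ?_⟩
      rw [kosz_d]
      exact hw) i
  obtain ⟨χ⟩ := homology_of_zero
    ((((tensoringLeft (ModuleCat.{0} A)).obj (ModuleCat.of A R)).mapHomologicalComplex _).obj
      (kosz s)) (by
      intro n
      change (ModuleCat.of A R) ◁ (kosz s).d (n + 1) n = 0
      rw [kosz_d]
      have hz : LinearMap.lTensor R (kd s n) = 0 := by
        refine TensorProduct.ext' (fun r w => ?_)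
        change r ⊗ₜ (kd s n w) = 0
        have hw := kd_smul_top I s hs n w
        have : (I • ⊤ : Submodule A (⋀[A]^n P)) ≤
            LinearMap.ker (TensorProduct.mk A R (⋀[A]^n P) r) := by
          rw [Submodule.smul_le]
          intro a ha x _
          rw [LinearMap.mem_ker, TensorProduct.mk_apply, ← smul_tmul, hR a ha, zero_tmul]
        exact this hw
      ext1
      exact hz) i
  exact ⟨(φ ≪≫ χ).toLinearEquiv⟩

end TorK

section Ext

set_option linter.unusedSectionVars false

variable {A R P M : Type} [CommRing A] [CommRing R] [Algebra A R] [AddCommGroup P] [Module A P]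
  [AddCommGroup M] [Module R M] [Module A M] [IsScalarTower A R M]
  (I : Ideal A) (hI : ∀ a ∈ I, algebraMap A R a = 0)

/-- The alternating map `p ↦ 1 ⊗ (p₁ ∧ ... ∧ pₙ)`. -/
noncomputable def qalt (n : ℕ) : P [⋀^Fin n]→ₗ[A] (R ⊗[A] ⋀[A]^n P) :=
  (TensorProduct.mk A R (⋀[A]^n P) 1).compAlternatingMap (exteriorPower.ιMulti A n)

lemma qalt_apply (n : ℕ) (p : Fin n → P) :
    qalt (A := A) (R := R) n p = 1 ⊗ₜ exteriorPower.ιMulti A n p := rfl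

include hI in
lemma qalt_update (n : ℕ) (p : Fin n → P) (j : Fin n) (v : P)
    (hv : v ∈ (I • ⊤ : Submodule A P)) :
    qalt (A := A) (R := R) n (Function.update p j v) = 0 := by
  have : (I • ⊤ : Submodule A P) ≤
      LinearMap.ker ((qalt (A := A) (R := R) n).toMultilinearMap.toLinearMap p j) := by
    rw [Submodule.smul_le]
    intro a ha x _
    rw [LinearMap.mem_ker, map_smul, ← algebraMap_smul R, hI a ha, zero_smul]
  exact this hv

include hI in
lemma qalt_congr (n : ℕ) (p p' : Fin n → P)
    (h : ∀ k, p k - p' k ∈ (I • ⊤ : Submodule A P)) :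
    qalt (A := A) (R := R) n p = qalt n p' := by
  have key : ∀ T : Finset (Fin n), qalt (A := A) (R := R) n (T.piecewise p p') = qalt n p' := by
    intro T
    induction T using Finset.induction_on with
    | empty => simp
    | insert j T hj ih =>
      rw [Finset.piecewise_insert]
      have e : p j = (p j - p' j) + p' j := by abel
      rw [e, AlternatingMap.map_update_add, qalt_update I hI n _ j _ (h j), zero_add, ← ih]
      congr 1
      rw [Function.update_eq_self_iff]
      simp [hj]
  simpa using key Finset.univ

variable (ψ : P →ₗ[A] M) (hψ : Function.Surjective ψ)
  (hker : ∀ p, ψ p = 0 → p ∈ (I • ⊤ : Submodule A P))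

include hI hker in
lemma qalt_congr' (n : ℕ) (p p' : Fin n → P) (h : ∀ k, ψ (p k) = ψ (p' k)) :
    qalt (A := A) (R := R) n p = qalt n p' :=
  qalt_congr I hI n p p' (fun k => hker _ (by rw [map_sub, h, sub_self]))

include hI hker hψ in
theorem ext_base (hf : Function.Surjective (algebraMap A R)) (n : ℕ) :
    Nonempty ((R ⊗[A] ⋀[A]^n P) ≃ₗ[R] ⋀[R]^n M) := by
  choose σ hσ using hψ
  have cg := qalt_congr' (R := R) I hI ψ hker n
  have this : ∀ (m : Fin n → M) (j : Fin n) (z : M),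
      qalt (A := A) (R := R) n (fun k => σ (Function.update m j z k)) =
        qalt n (Function.update (fun k => σ (m k)) j (σ z)) := by
    intro m j z
    congr 1
    ext k
    by_cases hk : k = j
    · subst hk; simp
    · simp [hk]
  have this2 : ∀ (p : Fin n → P) (j : Fin n) (z : P),
      (fun k => ψ (Function.update p j z k)) = Function.update (fun k => ψ (p k)) j (ψ z) := by
    intro m j z
    ext k
    by_cases hk : k = j
    · subst hk; simp
    · simp [hk]
  let g : M [⋀^Fin n]→ₗ[R] (R ⊗[A] ⋀[A]^n P) :=
    { toFun := fun m => qalt n (fun k => σ (m k))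
      map_update_add' := by
        intro inst m j x y
        obtain rfl : inst = instDecidableEqFin n := Subsingleton.elim _ _
        have e := AlternatingMap.map_update_add (qalt (A := A) (R := R) n)
          (fun k => σ (m k)) j (σ x) (σ y)
        rw [this, this, this, ← e]
        apply cg
        intro k
        by_cases hk : k = j
        · subst hk; simp [hσ]
        · simp [hk]
      map_update_smul' := by
        intro inst m j c x
        obtain rfl : inst = instDecidableEqFin n := Subsingleton.elim _ _
        obtain ⟨a, rfl⟩ := hf c
        have e := AlternatingMap.map_update_smul (qalt (A := A) (R := R) n)
          (fun k => σ (m k)) j a (σ x)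
        rw [this, this, algebraMap_smul, algebraMap_smul, ← e]
        apply cg
        intro k
        by_cases hk : k = j
        · subst hk; simp [hσ]
        · simp [hk]
      map_eq_zero_of_eq' := by
        intro m j k h1 h2
        exact (qalt n).map_eq_zero_of_eq _ (by simp [h1]) h2 }
  have gι : ∀ m, g m = 1 ⊗ₜ exteriorPower.ιMulti A n (fun k => σ (m k)) := fun _ => rfl
  let h : P [⋀^Fin n]→ₗ[A] ⋀[R]^n M :=
    { toFun := fun p => exteriorPower.ιMulti R n (fun k => ψ (p k))
      map_update_add' := by
        intro inst m j x y
        obtain rfl : inst = instDecidableEqFin n := Subsingleton.elim _ _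
        rw [this2, this2, this2, map_add, AlternatingMap.map_update_add]
      map_update_smul' := by
        intro inst m j c x
        obtain rfl : inst = instDecidableEqFin n := Subsingleton.elim _ _
        rw [this2, this2, map_smul, ← algebraMap_smul R c (ψ x), AlternatingMap.map_update_smul,
          algebraMap_smul]
      map_eq_zero_of_eq' := by
        intro m j k h1 h2
        exact (exteriorPower.ιMulti R n).map_eq_zero_of_eq _ (by simp [h1]) h2 }
  let F : (R ⊗[A] ⋀[A]^n P) →ₗ[R] ⋀[R]^n M :=
    LinearMap.liftBaseChange R (exteriorPower.alternatingMapLinearEquiv h)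
  let G : ⋀[R]^n M →ₗ[R] (R ⊗[A] ⋀[A]^n P) := exteriorPower.alternatingMapLinearEquiv g
  refine ⟨LinearEquiv.ofLinearMap F G ?_ ?_⟩
  · apply exteriorPower.linearMap_ext
    ext1 m
    change F (G (exteriorPower.ιMulti R n m)) = exteriorPower.ιMulti R n m
    have e1 : G (exteriorPower.ιMulti R n m) = g m :=
      exteriorPower.alternatingMapLinearEquiv_apply_ιMulti g m
    rw [e1, gι]
    have e2 := exteriorPower.alternatingMapLinearEquiv_apply_ιMulti h (fun k => σ (m k))
    change LinearMap.liftBaseChange R _ _ = _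
    rw [LinearMap.liftBaseChange_tmul, one_smul, e2]
    change exteriorPower.ιMulti R n (fun k => ψ (σ (m k))) = _
    simp only [hσ]
  · apply TensorProduct.AlgebraTensorModule.curry_injective
    apply LinearMap.ext_ring
    apply exteriorPower.linearMap_ext
    ext1 p
    change G (F (1 ⊗ₜ exteriorPower.ιMulti A n p)) = 1 ⊗ₜ exteriorPower.ιMulti A n p
    have e2 := exteriorPower.alternatingMapLinearEquiv_apply_ιMulti h p
    have e3 : F (1 ⊗ₜ exteriorPower.ιMulti A n p) = h p := by
      change LinearMap.liftBaseChange R _ _ = _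
      rw [LinearMap.liftBaseChange_tmul, one_smul, e2]
    rw [e3]
    have e1 : G (h p) = g (fun k => ψ (p k)) :=
      exteriorPower.alternatingMapLinearEquiv_apply_ιMulti g _
    rw [e1]
    exact cg _ _ (fun k => hσ _)

end Ext

section Final

set_option linter.unusedSectionVars false

open KaehlerDifferential

variable (k R : Type) [Field k] [CharZero k] [CommRing R] [Algebra k R]
    [Algebra.FormallySmooth k R] [Algebra.FiniteType k R]

lemma sub_mem_ideal (x : R ⊗[k] R) :
    x - (Algebra.TensorProduct.lmul' k x : R) ⊗ₜ[k] (1 : R) ∈ KaehlerDifferential.ideal k R := by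
  change _ = _
  rw [map_sub, sub_eq_zero]
  simp

lemma fromIdeal_eq_zero (z : KaehlerDifferential.ideal k R) :
    fromIdeal k R z = 0 ↔ (z : R ⊗[k] R) ∈ KaehlerDifferential.ideal k R ^ 2 :=
  Ideal.toCotangent_eq_zero _ z

lemma smul_omega (x : R ⊗[k] R) (m : Ω[R⁄k]) :
    x • m = (Algebra.TensorProduct.lmul' k x : R) • m := by
  have h2 : ∀ y ∈ KaehlerDifferential.ideal k R, y • m = 0 := by
    intro y hy
    obtain ⟨z, rfl⟩ := fromIdeal_surjective k R m
    rw [← map_smul, fromIdeal_eq_zero, pow_two]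
    exact Ideal.mul_mem_mul hy z.2
  have h1 := h2 _ (sub_mem_ideal k R x)
  rw [sub_smul, sub_eq_zero] at h1
  rw [h1]
  have := algebraMap_smul (R ⊗[k] R) (Algebra.TensorProduct.lmul' k x : R) m
  rw [← this]; rfl

/-- The derivation `x ⊗ y ↦ x • D y` of the enveloping algebra. -/
noncomputable def delta : Derivation R (R ⊗[k] R) (Ω[R⁄k]) :=
  Derivation.mk' ((D k R).tensorProductTo) (fun a b => by
    rw [Derivation.tensorProductTo_mul, smul_omega, smul_omega])

instance : Module.Projective (R ⊗[k] R) (Ω[(R ⊗[k] R)⁄R]) := inferInstance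
instance : Module.Finite (R ⊗[k] R) (Ω[(R ⊗[k] R)⁄R]) := inferInstance
instance : IsNoetherianRing (R ⊗[k] R) :=
  have : Algebra.FiniteType k (R ⊗[k] R) :=
    Algebra.FiniteType.trans (S := R) inferInstance inferInstance
  Algebra.FiniteType.isNoetherianRing k _

/-- The induced map on differentials. -/
noncomputable def psi : Ω[(R ⊗[k] R)⁄R] →ₗ[R ⊗[k] R] Ω[R⁄k] :=
  (delta k R).liftKaehlerDifferential

lemma psi_D (x : KaehlerDifferential.ideal k R) :
    psi k R (D R (R ⊗[k] R) (x : R ⊗[k] R)) = fromIdeal k R x := by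
  have h := (delta k R).liftKaehlerDifferential_comp_D (x : R ⊗[k] R)
  exact h.trans (KaehlerDifferential.D_tensorProductTo x)

lemma psi_surj : Function.Surjective (psi k R) := by
  intro m
  obtain ⟨z, rfl⟩ := fromIdeal_surjective k R m
  exact ⟨_, psi_D k R z⟩

lemma D_sq (x : R ⊗[k] R) (hx : x ∈ KaehlerDifferential.ideal k R ^ 2) :
    D R (R ⊗[k] R) x ∈ (KaehlerDifferential.ideal k R • ⊤ :
      Submodule (R ⊗[k] R) (Ω[(R ⊗[k] R)⁄R])) := by
  rw [pow_two] at hx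
  induction hx using Submodule.mul_induction_on' with
  | mem_mul_mem a ha b hb =>
    rw [Derivation.leibniz]
    exact add_mem (Submodule.smul_mem_smul ha trivial) (Submodule.smul_mem_smul hb trivial)
  | add a _ b _ h1 h2 => rw [map_add]; exact add_mem h1 h2

lemma exists_s : ∃ s : Module.Dual (R ⊗[k] R) (Ω[(R ⊗[k] R)⁄R]),
    (∀ p, s p ∈ KaehlerDifferential.ideal k R) ∧
    (∀ x ∈ KaehlerDifferential.ideal k R,
      s (D R (R ⊗[k] R) x) - x ∈ KaehlerDifferential.ideal k R ^ 2) ∧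
    (∀ p, D R (R ⊗[k] R) (s p) - p ∈ (KaehlerDifferential.ideal k R • ⊤ :
      Submodule (R ⊗[k] R) (Ω[(R ⊗[k] R)⁄R]))) ∧
    (∀ p, psi k R p = 0 → s p ∈ KaehlerDifferential.ideal k R ^ 2) := by
  obtain ⟨σ, hσ⟩ := Module.projective_lifting_property (fromIdeal k R) (psi k R)
    (fromIdeal_surjective k R)
  have hσ' : ∀ p, fromIdeal k R (σ p) = psi k R p := fun p => LinearMap.congr_fun hσ p
  have hsd : ∀ x ∈ KaehlerDifferential.ideal k R,
      (σ (D R (R ⊗[k] R) x) : R ⊗[k] R) - x ∈ KaehlerDifferential.ideal k R ^ 2 := by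
    intro x hx
    have h : fromIdeal k R (σ (D R (R ⊗[k] R) x) - ⟨x, hx⟩) = 0 := by
      rw [map_sub, hσ', sub_eq_zero]
      exact psi_D k R ⟨x, hx⟩
    exact (fromIdeal_eq_zero k R _).mp h
  refine ⟨(KaehlerDifferential.ideal k R).subtype ∘ₗ σ, fun p => (σ p).2, hsd, ?_, ?_⟩
  · intro p
    change D R (R ⊗[k] R) (σ p : R ⊗[k] R) - p ∈ _
    have hp : p ∈ Submodule.span (R ⊗[k] R) (Set.range (D R (R ⊗[k] R))) := by
      rw [span_range_derivation]; trivial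
    induction hp using Submodule.span_induction with
    | mem p hp =>
      obtain ⟨x, rfl⟩ := hp
      have hy := sub_mem_ideal k R x
      have hD : D R (R ⊗[k] R) (x - (Algebra.TensorProduct.lmul' k x : R) ⊗ₜ[k] (1 : R))
          = D R (R ⊗[k] R) x := by
        rw [map_sub, sub_eq_self]
        exact (D R (R ⊗[k] R)).map_algebraMap (Algebra.TensorProduct.lmul' k x : R)
      have h := D_sq k R _ (hsd _ hy)
      rw [map_sub, hD] at h
      exact h
    | zero => simp
    | add x y _ _ h1 h2 =>
      have := add_mem h1 h2
      rw [map_add, Submodule.coe_add, map_add]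
      convert this using 1
      abel
    | smul a x _ h =>
      have h3 : (σ x : R ⊗[k] R) • D R (R ⊗[k] R) a ∈ (KaehlerDifferential.ideal k R • ⊤ :
          Submodule (R ⊗[k] R) (Ω[(R ⊗[k] R)⁄R])) := Submodule.smul_mem_smul (σ x).2 trivial
      have := add_mem (Submodule.smul_mem _ a h) h3
      rw [map_smul, Submodule.coe_smul, smul_eq_mul, Derivation.leibniz]
      convert this using 1
      rw [smul_sub]; abel
  · intro p hp
    rw [← hσ', fromIdeal_eq_zero] at hp
    exact hp

lemma hunit (m : ℕ) (hm : m ≠ 0) : IsUnit (m : R ⊗[k] R) := by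
  have : (m : R ⊗[k] R) = algebraMap k (R ⊗[k] R) (m : k) := by simp
  rw [this]
  exact (IsUnit.mk0 (m : k) (Nat.cast_ne_zero.mpr hm)).map _

theorem main_aux (i : ℕ) :
    letI : Algebra (R ⊗[k] R) R := (Algebra.TensorProduct.lmul' k (S := R)).toRingHom.toAlgebra
    ∃ e : (((Tor (ModuleCat.{0} (R ⊗[k] R)) i).obj (ModuleCat.of (R ⊗[k] R) R)).obj
          (ModuleCat.of (R ⊗[k] R) R)) ≃+ ⋀[R]^i (Ω[R⁄k]),
      ∀ (a : R ⊗[k] R) x, e (a • x) = (Algebra.TensorProduct.lmul' k a : R) • e x := by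
  let mA : Module (R ⊗[k] R) (Ω[R⁄k]) := inferInstance
  let : Algebra (R ⊗[k] R) R := (Algebra.TensorProduct.lmul' k (S := R)).toRingHom.toAlgebra
  have am : ∀ a : R ⊗[k] R, algebraMap (R ⊗[k] R) R a = Algebra.TensorProduct.lmul' k a :=
    fun _ => rfl
  have hI : ∀ a : R ⊗[k] R, algebraMap (R ⊗[k] R) R a = 0 ↔ a ∈ KaehlerDifferential.ideal k R :=
    fun _ => Iff.rfl
  have hsurj : Function.Surjective (algebraMap (R ⊗[k] R) R) := fun r => ⟨r ⊗ₜ 1, by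
    rw [am]; simp⟩
  have tow : @IsScalarTower (R ⊗[k] R) R (Ω[R⁄k]) _ _ mA.toSMul :=
    @IsScalarTower.of_algebraMap_smul (R ⊗[k] R) R (Ω[R⁄k]) _ _ _ _ mA.toSMul
      (fun a m => (smul_omega k R a m).symm)
  obtain ⟨s, hs, hsd, hds, hsk⟩ := exists_s k R
  obtain ⟨e1⟩ := tor_koszul (D R (R ⊗[k] R)).toLinearMap.toAddMonoidHom
    (fun a b => (D R (R ⊗[k] R)).leibniz a b) (KaehlerDifferential.ideal k R) s hs hsd hds
    (hunit k R) R (fun a ha r => by rw [Algebra.smul_def, (hI a).mpr ha, zero_mul])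
    (Algebra.linearMap (R ⊗[k] R) R) hsurj hI i
  obtain ⟨e2⟩ := @ext_base (R ⊗[k] R) R (Ω[(R ⊗[k] R)⁄R]) (Ω[R⁄k]) _ _ _ _ _ _ _ mA tow
    (KaehlerDifferential.ideal k R) (fun a ha => (hI a).mpr ha)
    (psi k R) (psi_surj k R)
    (fun p hp => by
      have := sub_mem (D_sq k R _ (hsk p hp)) (hds p)
      rwa [sub_sub_cancel] at this) hsurj i
  refine ⟨e1.toAddEquiv.trans e2.toAddEquiv, fun a x => ?_⟩
  change e2 (e1 (a • x)) = algebraMap (R ⊗[k] R) R a • e2 (e1 x)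
  rw [← map_smul e2, map_smul e1, algebraMap_smul]

end Final

end HKR

/-- **Hochschild–Kostant–Rosenberg theorem, affine homological case.**
Let `k` be a field of characteristic zero and `R` a smooth commutative `k`-algebra
(formally smooth and of finite type over `k`).  Regard `R` as a module over the
enveloping algebra `R ⊗[k] R` via the multiplication map `R ⊗[k] R → R`.  Then for every
`i ≥ 0` there is an isomorphism of `R`-modules
`Tor_i^{R⊗R}(R, R) ≅ ⋀ᵢ_R Ω_{R/k}`,
where the `R`-module structure on the Tor group is obtained by restricting scalars along
`R → R ⊗[k] R`, `r ↦ r ⊗ 1`. -/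
theorem hkr_affine_homology (k : Type) [Field k] [CharZero k]
    (R : Type) [CommRing R] [Algebra k R]
    [Algebra.FormallySmooth k R] [Algebra.FiniteType k R] (i : ℕ) :
    letI : Module (R ⊗[k] R) R :=
      Module.compHom R (Algebra.TensorProduct.lmul' k (S := R)).toRingHom
    letI : Module R
        (((Tor (ModuleCat (R ⊗[k] R)) i).obj (ModuleCat.of (R ⊗[k] R) R)).obj
          (ModuleCat.of (R ⊗[k] R) R)) :=
      Module.compHom _ (algebraMap R (R ⊗[k] R))
    Nonempty
      ((((Tor (ModuleCat (R ⊗[k] R)) i).obj (ModuleCat.of (R ⊗[k] R) R)).obj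
          (ModuleCat.of (R ⊗[k] R) R)) ≃ₗ[R] ⋀[R]^i (Ω[R⁄k])) := by
  let m1 : Module (R ⊗[k] R) R :=
    Module.compHom R (Algebra.TensorProduct.lmul' k (S := R)).toRingHom
  let m2 : Module R
      (((Tor (ModuleCat (R ⊗[k] R)) i).obj (ModuleCat.of (R ⊗[k] R) R)).obj
        (ModuleCat.of (R ⊗[k] R) R)) :=
    Module.compHom _ (algebraMap R (R ⊗[k] R))
  obtain ⟨e, he⟩ := HKR.main_aux k R i
  refine ⟨{ toFun := e, invFun := e.symm, left_inv := e.left_inv, right_inv := e.right_inv,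
            map_add' := e.map_add, map_smul' := fun r x => ?_ }⟩
  refine (he (algebraMap R (R ⊗[k] R) r) x).trans ?_
  have : Algebra.TensorProduct.lmul' k (algebraMap R (R ⊗[k] R) r) = r := by
    rw [Algebra.TensorProduct.algebraMap_apply]; simp
  rw [this]
  rfl
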